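/- Let A be a unital associative superalgebra over a commutative unital ring K, regarded as a Lie superalgebra with [a,b] = ab − (−1)^{|a||b|}ba. Then there is an exact sequence of supermodules (A/[A,A]) ⊗_K HC₁(A) → H̄₁(A, V(A)) → H̄₁(A, [A,A]) → HC₁(A) → HC₁^M(A) → [A,A]/[A,[A,A]] → 0. -/

import Mathlib

open scoped TensorProduct

namespace SuperNA

/-- The sign `(-1)^(|α||β|)` appearing in super-algebra identities. -/
def ssign (α β : ZMod 2) : ℤ := (-1 : ℤ) ^ (α.val * β.val)

/-- A Lie superalgebra over a commutative unital ring `K`: a `ℤ/2`-graded `K`-module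
with a bilinear bracket satisfying the graded skew-symmetry, the graded Jacobi
(Leibniz form) identity, and `[x₀,x₀] = 0` for even `x₀`. -/
structure LieSuperalgebra (K : Type) [CommRing K] : Type 1 where
  carrier : Type
  [isAddCommGroup : AddCommGroup carrier]
  [isModule : Module K carrier]
  grading : ZMod 2 → Submodule K carrier
  isInternal : DirectSum.IsInternal grading
  bracket : carrier →ₗ[K] carrier →ₗ[K] carrier
  bracket_grading : ∀ (α β : ZMod 2) (x y : carrier),
    x ∈ grading α → y ∈ grading β → bracket x y ∈ grading (α + β)
  super_skew : ∀ (α β : ZMod 2) (x y : carrier), x ∈ grading α → y ∈ grading β →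
    bracket x y = -(ssign α β • bracket y x)
  super_jacobi : ∀ (α β : ZMod 2) (x y : carrier), x ∈ grading α → y ∈ grading β →
    ∀ z : carrier, bracket x (bracket y z)
      = bracket (bracket x y) z + ssign α β • bracket y (bracket x z)
  bracket_self_even : ∀ x ∈ grading 0, bracket x x = 0

attribute [instance] LieSuperalgebra.isAddCommGroup LieSuperalgebra.isModule

variable {K : Type} [CommRing K]

instance : CoeSort (LieSuperalgebra K) Type := ⟨LieSuperalgebra.carrier⟩

/-- A homomorphism of Lie superalgebras: an even linear map preserving brackets. -/
structure LieSuperHom (L M : LieSuperalgebra K) where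
  toLinear : L.carrier →ₗ[K] M.carrier
  map_grading : ∀ (α : ZMod 2), ∀ x ∈ L.grading α, toLinear x ∈ M.grading α
  map_bracket : ∀ x y, toLinear (L.bracket x y) = M.bracket (toLinear x) (toLinear y)

/-- An action of the Lie superalgebra `P` on the Lie superalgebra `M`. -/
structure LieSuperAction (P M : LieSuperalgebra K) where
  act : P.carrier →ₗ[K] M.carrier →ₗ[K] M.carrier
  act_grading : ∀ (α β : ZMod 2) (p : P.carrier) (m : M.carrier),
    p ∈ P.grading α → m ∈ M.grading β → act p m ∈ M.grading (α + β)
  act_bracket : ∀ (α β : ZMod 2) (p p' : P.carrier), p ∈ P.grading α → p' ∈ P.grading β →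
    ∀ m : M.carrier, act (P.bracket p p') m = act p (act p' m) - ssign α β • act p' (act p m)
  act_super_der : ∀ (α β : ZMod 2) (p : P.carrier) (m : M.carrier),
    p ∈ P.grading α → m ∈ M.grading β → ∀ m' : M.carrier,
    act p (M.bracket m m') = M.bracket (act p m) m' + ssign α β • M.bracket m (act p m')

/-- Two mutual actions are compatible. -/
structure AreCompatible {M N : LieSuperalgebra K}
    (aMN : LieSuperAction M N) (aNM : LieSuperAction N M) : Prop where
  compat_left : ∀ (α β : ZMod 2) (m : M.carrier) (n : N.carrier),
    m ∈ M.grading α → n ∈ N.grading β → ∀ n' : N.carrier,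
    aMN.act (aNM.act n m) n' = -(ssign α β • N.bracket (aMN.act m n) n')
  compat_right : ∀ (α β : ZMod 2) (m : M.carrier) (n : N.carrier),
    m ∈ M.grading α → n ∈ N.grading β → ∀ m' : M.carrier,
    aNM.act (aMN.act m n) m' = -(ssign α β • M.bracket (aNM.act n m) m')

/-- A crossed module of Lie superalgebras `∂ : M → P`. -/
structure CrossedModule (M P : LieSuperalgebra K) where
  act : LieSuperAction P M
  d : LieSuperHom M P
  cm_act : ∀ (p : P.carrier) (m : M.carrier), d.toLinear (act.act p m) = P.bracket p (d.toLinear m)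
  cm_peiffer : ∀ (m m' : M.carrier), act.act (d.toLinear m) m' = M.bracket m m'

/-- A morphism of crossed `P`-modules. -/
structure CMHom {P M N : LieSuperalgebra K} (cmM : CrossedModule M P) (cmN : CrossedModule N P) where
  hom : LieSuperHom M N
  equivariant : ∀ (p : P.carrier) (m : M.carrier),
    hom.toLinear (cmM.act.act p m) = cmN.act.act p (hom.toLinear m)
  comm : ∀ m : M.carrier, cmN.d.toLinear (hom.toLinear m) = cmM.d.toLinear m

/-- The data of a family of "tensor symbols" in a Lie superalgebra `Q`, indexed by pairs of
homogeneous elements of `M` and `N`, satisfying the defining relations of the non-abelian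
tensor product `M ⊗ N`. -/
structure TensorData {M N : LieSuperalgebra K}
    (aMN : LieSuperAction M N) (aNM : LieSuperAction N M) (Q : LieSuperalgebra K) where
  pair : (α β : ZMod 2) → M.grading α → N.grading β → Q.carrier
  pair_grading : ∀ (α β : ZMod 2) (m : M.grading α) (n : N.grading β),
    pair α β m n ∈ Q.grading (α + β)
  pair_smul_left : ∀ (α β : ZMod 2) (c : K) (m : M.grading α) (n : N.grading β),
    pair α β (c • m) n = c • pair α β m n
  pair_smul_right : ∀ (α β : ZMod 2) (c : K) (m : M.grading α) (n : N.grading β),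
    pair α β m (c • n) = c • pair α β m n
  pair_add_left : ∀ (α β : ZMod 2) (m m' : M.grading α) (n : N.grading β),
    pair α β (m + m') n = pair α β m n + pair α β m' n
  pair_add_right : ∀ (α β : ZMod 2) (m : M.grading α) (n n' : N.grading β),
    pair α β m (n + n') = pair α β m n + pair α β m n'
  pair_bracket_left : ∀ (α α' β : ZMod 2) (m : M.grading α) (m' : M.grading α') (n : N.grading β),
    pair (α + α') β ⟨M.bracket m.1 m'.1, M.bracket_grading α α' m.1 m'.1 m.2 m'.2⟩ n
      = pair α (α' + β) m ⟨aMN.act m'.1 n.1, aMN.act_grading α' β m'.1 n.1 m'.2 n.2⟩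
        - ssign α α' • pair α' (α + β) m' ⟨aMN.act m.1 n.1, aMN.act_grading α β m.1 n.1 m.2 n.2⟩
  pair_bracket_right : ∀ (α β β' : ZMod 2) (m : M.grading α) (n : N.grading β) (n' : N.grading β'),
    pair α (β + β') m ⟨N.bracket n.1 n'.1, N.bracket_grading β β' n.1 n'.1 n.2 n'.2⟩
      = ssign β' (α + β) • pair (β' + α) β
          ⟨aNM.act n'.1 m.1, aNM.act_grading β' α n'.1 m.1 n'.2 m.2⟩ n
        - ssign α β • pair (β + α) β'
          ⟨aNM.act n.1 m.1, aNM.act_grading β α n.1 m.1 n.2 m.2⟩ n'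
  pair_bracket_pair : ∀ (α β α' β' : ZMod 2) (m : M.grading α) (n : N.grading β)
      (m' : M.grading α') (n' : N.grading β'),
    Q.bracket (pair α β m n) (pair α' β' m' n')
      = -(ssign α β • pair (β + α) (α' + β')
          ⟨aNM.act n.1 m.1, aNM.act_grading β α n.1 m.1 n.2 m.2⟩
          ⟨aMN.act m'.1 n'.1, aMN.act_grading α' β' m'.1 n'.1 m'.2 n'.2⟩)

/-- `(T, ι)` is *the* non-abelian tensor product `M ⊗ N`: it is initial among Lie
superalgebras equipped with tensor symbols satisfying the defining relations.  This
universal property characterizes the Lie superalgebra presented by the generators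
`m ⊗ n` and the relations of the non-abelian tensor product, uniquely up to isomorphism. -/
def IsNATensor {M N : LieSuperalgebra K} (aMN : LieSuperAction M N) (aNM : LieSuperAction N M)
    (T : LieSuperalgebra K) (ι : TensorData aMN aNM T) : Prop :=
  ∀ (Q : LieSuperalgebra K) (d : TensorData aMN aNM Q),
    ∃! f : LieSuperHom T Q,
      ∀ (α β : ZMod 2) (m : M.grading α) (n : N.grading β),
        f.toLinear (ι.pair α β m n) = d.pair α β m n

/-- Tensor-symbol data additionally satisfying the relations of the non-abelian
exterior square `L ∧ L` (relative to an action `a` of `L` on itself). -/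
structure ExtSqData {L : LieSuperalgebra K} (a : LieSuperAction L L) (Q : LieSuperalgebra K)
    extends TensorData a a Q where
  pair_alt : ∀ (α β : ZMod 2) (x : L.grading α) (y : L.grading β),
    toTensorData.pair α β x y + ssign α β • toTensorData.pair β α y x = 0
  pair_self : ∀ x : L.grading 0, toTensorData.pair 0 0 x x = 0

/-- `(E, ι)` is the non-abelian exterior square `L ∧ L`. -/
def IsNAExtSq {L : LieSuperalgebra K} (a : LieSuperAction L L) (E : LieSuperalgebra K)
    (ι : ExtSqData a E) : Prop :=
  ∀ (Q : LieSuperalgebra K) (d : ExtSqData a Q),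
    ∃! f : LieSuperHom E Q,
      ∀ (α β : ZMod 2) (x : L.grading α) (y : L.grading β),
        f.toLinear (ι.pair α β x y) = d.pair α β x y

/-- Generating family for a free Lie superalgebra on a graded set. -/
structure FreeData (X : Type) (degX : X → ZMod 2) (F : LieSuperalgebra K) where
  gen : X → F.carrier
  gen_grading : ∀ x, gen x ∈ F.grading (degX x)

/-- `F` (with generators `i`) is the free Lie superalgebra on the graded set `(X, degX)`. -/
def IsFreeLieSuper {X : Type} (degX : X → ZMod 2) (F : LieSuperalgebra K)
    (i : FreeData X degX F) : Prop :=
  ∀ (M : LieSuperalgebra K) (j : FreeData X degX M),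
    ∃! h : LieSuperHom F M, ∀ x, h.toLinear (i.gen x) = j.gen x

/-- The submodule spanned by brackets `[S, T]`. -/
def bracketSpan (L : LieSuperalgebra K) (S T : Submodule K L.carrier) :
    Submodule K L.carrier :=
  Submodule.span K {z | ∃ x ∈ S, ∃ y ∈ T, z = L.bracket x y}

/-- Lower central series of a (sub-)Lie superalgebra `S ⊆ L`: `lcs 0 = S`,
`lcs (n+1) = [S, lcs n]`.  `S` is nilpotent of class `≤ c` iff `lcs c = ⊥`. -/
def lcs (L : LieSuperalgebra K) (S : Submodule K L.carrier) : ℕ → Submodule K L.carrier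
  | 0 => S
  | n + 1 => bracketSpan L S (lcs L S n)

/-- Derived series of `S ⊆ L`.  `S` is solvable of derived length `≤ c` iff `ds c = ⊥`. -/
def ds (L : LieSuperalgebra K) (S : Submodule K L.carrier) : ℕ → Submodule K L.carrier
  | 0 => S
  | n + 1 => bracketSpan L (ds L S n) (ds L S n)

/-- `S ⊆ L` is `n`-Engel: `ad(x)ⁿ = 0` on `S` for every `x ∈ S`. -/
def IsEngel (L : LieSuperalgebra K) (S : Submodule K L.carrier) (n : ℕ) : Prop :=
  ∀ x ∈ S, ∀ y ∈ S, ((L.bracket x) ^ n) y = 0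

section Grading

variable {V W : Type} [AddCommGroup V] [Module K V] [AddCommGroup W] [Module K W]

/-- The induced grading on a submodule. -/
def gradeSub (g : ZMod 2 → Submodule K V) (S : Submodule K V) : ZMod 2 → Submodule K S :=
  fun α => (g α).comap S.subtype

/-- The induced grading on a quotient module. -/
def gradeQuot (g : ZMod 2 → Submodule K V) (S : Submodule K V) : ZMod 2 → Submodule K (V ⧸ S) :=
  fun α => (g α).map S.mkQ

/-- The induced grading on a tensor product of supermodules. -/
def gradeTensor (gV : ZMod 2 → Submodule K V) (gW : ZMod 2 → Submodule K W) :
    ZMod 2 → Submodule K (V ⊗[K] W) :=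
  fun γ => Submodule.span K {t | ∃ (α β : ZMod 2) (v : V) (w : W),
    α + β = γ ∧ v ∈ gV α ∧ w ∈ gW β ∧ t = v ⊗ₜ[K] w}

/-- A linear equivalence is an isomorphism of supermodules for the given gradings. -/
def SuperEquiv (gV : ZMod 2 → Submodule K V) (gW : ZMod 2 → Submodule K W)
    (e : V ≃ₗ[K] W) : Prop :=
  ∀ α, (gV α).map e.toLinearMap = gW α

end Grading

/-- An associative (unital) superalgebra over `K`. -/
structure AssocSuperalgebra (K : Type) [CommRing K] : Type 1 where
  carrier : Type
  [isRing : Ring carrier]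
  [isAlgebra : Algebra K carrier]
  grading : ZMod 2 → Submodule K carrier
  isInternal : DirectSum.IsInternal grading
  grading_mul : ∀ (α β : ZMod 2) (x y : carrier),
    x ∈ grading α → y ∈ grading β → x * y ∈ grading (α + β)
  one_mem : (1 : carrier) ∈ grading 0

attribute [instance] AssocSuperalgebra.isRing AssocSuperalgebra.isAlgebra

/-- A (not necessarily unital) associative superalgebra over `K`. -/
structure NuAssocSuperalgebra (K : Type) [CommRing K] : Type 1 where
  carrier : Type
  [isRing : NonUnitalRing carrier]
  [isModule : Module K carrier]
  [isTower : IsScalarTower K carrier carrier]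
  [isComm : SMulCommClass K carrier carrier]
  grading : ZMod 2 → Submodule K carrier
  isInternal : DirectSum.IsInternal grading
  grading_mul : ∀ (α β : ZMod 2) (x y : carrier),
    x ∈ grading α → y ∈ grading β → x * y ∈ grading (α + β)

attribute [instance] NuAssocSuperalgebra.isRing NuAssocSuperalgebra.isModule
  NuAssocSuperalgebra.isTower NuAssocSuperalgebra.isComm

/-- The super-alternating relations inside `L ⊗ L`, whose quotient is `Λ²(L)`. -/
def altRel (L : LieSuperalgebra K) : Submodule K (L.carrier ⊗[K] L.carrier) :=
  Submodule.span K {t | ∃ (α β : ZMod 2) (x : L.grading α) (y : L.grading β),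
    t = x.1 ⊗ₜ[K] y.1 + ssign α β • (y.1 ⊗ₜ[K] x.1)}

/-- The super-alternating relations inside `L ⊗ (L ⊗ L)`, whose quotient is `Λ³(L)`. -/
def altRel3 (L : LieSuperalgebra K) :
    Submodule K (L.carrier ⊗[K] (L.carrier ⊗[K] L.carrier)) :=
  Submodule.span K
    ({t | ∃ (x : L.carrier) (r : L.carrier ⊗[K] L.carrier), r ∈ altRel L ∧ t = x ⊗ₜ[K] r} ∪
     {t | ∃ (α β : ZMod 2) (x : L.grading α) (y : L.grading β) (z : L.carrier),
        t = x.1 ⊗ₜ[K] (y.1 ⊗ₜ[K] z) + ssign α β • (y.1 ⊗ₜ[K] (x.1 ⊗ₜ[K] z))})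

/-- The graded submodule `I(A) ⊆ A ⊗_K A` of the cyclic relations. -/
def IA {K : Type} [CommRing K] (A : NuAssocSuperalgebra K) :
    Submodule K (A.carrier ⊗[K] A.carrier) :=
  Submodule.span K
    ({t | ∃ (α β : ZMod 2) (a : A.grading α) (b : A.grading β),
        t = a.1 ⊗ₜ[K] b.1 + ssign α β • (b.1 ⊗ₜ[K] a.1)} ∪
     {t | ∃ (α β γ : ZMod 2) (a : A.grading α) (b : A.grading β) (c : A.grading γ),
        t = (a.1 * b.1) ⊗ₜ[K] c.1 - a.1 ⊗ₜ[K] (b.1 * c.1)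
            + ssign γ (α + β) • ((c.1 * a.1) ⊗ₜ[K] b.1)})

/-- The graded submodule `J(A) ⊆ A ⊗_K A` of the Milnor relations, whose quotient is the
first Milnor cyclic homology `HC₁^M(A)`. -/
def JA {K : Type} [CommRing K] (A : NuAssocSuperalgebra K) :
    Submodule K (A.carrier ⊗[K] A.carrier) :=
  Submodule.span K
    ({t | ∃ (α β : ZMod 2) (a : A.grading α) (b : A.grading β),
        t = a.1 ⊗ₜ[K] b.1 + ssign α β • (b.1 ⊗ₜ[K] a.1)} ∪
     {t | ∃ (α β γ : ZMod 2) (a : A.grading α) (b : A.grading β) (c : A.grading γ),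
        t = (a.1 * b.1) ⊗ₜ[K] c.1 - a.1 ⊗ₜ[K] (b.1 * c.1)
            + ssign γ (α + β) • ((c.1 * a.1) ⊗ₜ[K] b.1)} ∪
     {t | ∃ (α β γ : ZMod 2) (a : A.grading α) (b : A.grading β) (c : A.grading γ),
        t = a.1 ⊗ₜ[K] (b.1 * c.1) - ssign β γ • (a.1 ⊗ₜ[K] (c.1 * b.1))})

/-- `[A,A]`: the graded submodule generated by the super-commutators. -/
def commSpan {K : Type} [CommRing K] (A : NuAssocSuperalgebra K) : Submodule K A.carrier :=
  Submodule.span K {x | ∃ (α β : ZMod 2) (a : A.grading α) (b : A.grading β),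
    x = a.1 * b.1 - ssign α β • (b.1 * a.1)}

/-- `[A,[A,A]]`. -/
def commSpan2 {K : Type} [CommRing K] (A : NuAssocSuperalgebra K)
    (brA : A.carrier →ₗ[K] A.carrier →ₗ[K] A.carrier) : Submodule K A.carrier :=
  Submodule.span K {x | ∃ (a : A.carrier), ∃ y ∈ commSpan A, x = brA a y}

/-- A unital associative superalgebra is in particular a possibly-non-unital one. -/
def AssocSuperalgebra.toNu {K : Type} [CommRing K] (A : AssocSuperalgebra K) :
    NuAssocSuperalgebra K where
  carrier := A.carrier
  grading := A.grading
  isInternal := A.isInternal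
  grading_mul := A.grading_mul

section Homogeneous

variable {V W : Type} [AddCommGroup V] [Module K V] [AddCommGroup W] [Module K W]
  {g : ZMod 2 → Submodule K V} {g' : ZMod 2 → Submodule K W}

theorem bijective_coeLinearMap (h : DirectSum.IsInternal g) :
    Function.Bijective (DirectSum.coeLinearMap g) := h

/-- The homogeneous component of degree `α`. -/
noncomputable def gcomp (h : DirectSum.IsInternal g) (α : ZMod 2) : V →ₗ[K] g α :=
  DirectSum.component K (ZMod 2) (fun i => g i) α ∘ₗ
    (LinearEquiv.ofBijective (DirectSum.coeLinearMap g) (bijective_coeLinearMap h)).symm.toLinearMap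

theorem ofBijective_symm_of_mem (h : DirectSum.IsInternal g) {α : ZMod 2} {x : V}
    (hx : x ∈ g α) :
    (LinearEquiv.ofBijective (DirectSum.coeLinearMap g) (bijective_coeLinearMap h)).symm x
      = DirectSum.lof K (ZMod 2) (fun i => g i) α ⟨x, hx⟩ := by
  rw [LinearEquiv.symm_apply_eq]
  simp

theorem gcomp_of_mem (h : DirectSum.IsInternal g) {α : ZMod 2} {x : V} (hx : x ∈ g α) :
    gcomp h α x = ⟨x, hx⟩ := by
  simp [gcomp, ofBijective_symm_of_mem h hx, DirectSum.component.lof_self]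

theorem gcomp_of_mem_ne (h : DirectSum.IsInternal g) {α β : ZMod 2} {x : V} (hx : x ∈ g α)
    (hne : α ≠ β) : gcomp h β x = 0 := by
  simp [gcomp, ofBijective_symm_of_mem h hx, DirectSum.component.of, hne]

theorem homogeneous_induction (h : DirectSum.IsInternal g) {p : V → Prop}
    (hom : ∀ α, ∀ x ∈ g α, p x) (add : ∀ x y, p x → p y → p (x + y)) (x : V) : p x := by
  have hx : x ∈ ⨆ α, g α := by
    rw [h.submodule_iSup_eq_top]
    trivial
  exact Submodule.iSup_induction g (motive := p) hx hom (hom 0 0 (zero_mem _)) add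

theorem sum_gcomp (h : DirectSum.IsInternal g) (x : V) : ∑ α, (gcomp h α x : V) = x := by
  induction x using homogeneous_induction h with
  | hom α x hx =>
    rw [Finset.sum_eq_single α]
    · rw [gcomp_of_mem h hx]
    · intro β _ hne
      rw [gcomp_of_mem_ne h hx hne.symm]
      rfl
    · simp
  | add x y hx hy => simp [Finset.sum_add_distrib, hx, hy]

/-- Even maps commute with taking homogeneous components. -/
theorem gcomp_map (h : DirectSum.IsInternal g) (h' : DirectSum.IsInternal g') (f : V →ₗ[K] W)
    (hf : ∀ α, ∀ x ∈ g α, f x ∈ g' α) (α : ZMod 2) (x : V) :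
    (gcomp h' α (f x) : W) = f (gcomp h α x) := by
  induction x using homogeneous_induction h with
  | hom β x hx =>
    by_cases hβ : β = α
    · subst hβ
      rw [gcomp_of_mem h hx, gcomp_of_mem h' (hf _ _ hx)]
    · rw [gcomp_of_mem_ne h hx hβ, gcomp_of_mem_ne h' (hf _ _ hx) hβ]
      simp
  | add x y hx hy => simp [hx, hy]

theorem isInternal_of_proj (p : ZMod 2 → V →ₗ[K] V) (mem : ∀ α x, p α x ∈ g α)
    (same : ∀ α, ∀ x ∈ g α, p α x = x) (ne : ∀ α β, α ≠ β → ∀ x ∈ g α, p β x = 0)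
    (sum : ∀ x, ∑ α, p α x = x) : DirectSum.IsInternal g := by
  have key : ∀ (x : DirectSum (ZMod 2) fun i => g i) (α : ZMod 2),
      p α (DirectSum.coeLinearMap g x) = x α := by
    intro x α
    induction x using DirectSum.induction_on with
    | zero => simp
    | of β y =>
      rw [← DirectSum.lof_eq_of K, DirectSum.coeLinearMap_lof, DirectSum.lof_eq_of]
      by_cases h : β = α
      · subst h
        rw [same _ _ y.2, DirectSum.of_eq_same]
      · rw [ne _ _ h _ y.2, DirectSum.of_eq_of_ne _ _ _ (Ne.symm h)]
        rfl
    | add x y hx hy => simp [hx, hy]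
  have bij : Function.Bijective (DirectSum.coeLinearMap g) := by
    refine ⟨fun x y hxy => ?_, fun x => ?_⟩
    · ext α
      rw [← key, ← key, hxy]
    · have hx : DirectSum.coeLinearMap g
          (∑ α, DirectSum.lof K (ZMod 2) (fun i => g i) α ⟨p α x, mem α x⟩) = x := by
        simp only [map_sum, DirectSum.coeLinearMap_lof, sum]
      exact ⟨_, hx⟩
  exact bij

/-- A submodule is homogeneous when it contains the components of its elements. -/
def IsHomogeneousSub (h : DirectSum.IsInternal g) (S : Submodule K V) : Prop :=
  ∀ α, ∀ x ∈ S, (gcomp h α x : V) ∈ S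

theorem isHomogeneousSub_span (h : DirectSum.IsInternal g) {s : Set V}
    (hs : ∀ x ∈ s, ∃ α, x ∈ g α) : IsHomogeneousSub h (Submodule.span K s) := by
  intro α x hx
  induction hx using Submodule.span_induction with
  | mem x hx =>
    obtain ⟨β, hβ⟩ := hs x hx
    by_cases hne : β = α
    · subst hne
      rw [gcomp_of_mem h hβ]
      exact Submodule.subset_span hx
    · rw [gcomp_of_mem_ne h hβ hne]
      exact zero_mem _
  | zero => simp
  | add x y _ _ hx hy => simpa using add_mem hx hy
  | smul c x _ hx => simpa using Submodule.smul_mem _ c hx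

theorem isInternal_gradeSub (h : DirectSum.IsInternal g) {S : Submodule K V}
    (hS : IsHomogeneousSub h S) : DirectSum.IsInternal (gradeSub g S) := by
  refine isInternal_of_proj
    (fun α => ((g α).subtype ∘ₗ gcomp h α).restrict (p := S) (q := S) (hS α))
    (fun α x => (gcomp h α x.1).2) (fun α x hx => Subtype.ext ?_)
    (fun α β hne x hx => Subtype.ext ?_) (fun x => Subtype.ext ?_)
  · have hx' : x.1 ∈ g α := hx
    exact congrArg (Subtype.val : g α → V) (gcomp_of_mem h hx')
  · have hx' : x.1 ∈ g α := hx
    exact congrArg (Subtype.val : g β → V) (gcomp_of_mem_ne h hx' hne)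
  · rw [AddSubmonoidClass.coe_finsetSum]
    exact sum_gcomp h x.1

theorem isInternal_gradeQuot (h : DirectSum.IsInternal g) {S : Submodule K V}
    (hS : IsHomogeneousSub h S) : DirectSum.IsInternal (gradeQuot g S) := by
  refine isInternal_of_proj
    (fun α => S.mapQ S ((g α).subtype ∘ₗ gcomp h α) (hS α)) ?_ ?_ ?_ ?_
  · intro α x
    obtain ⟨x, rfl⟩ := S.mkQ_surjective x
    exact ⟨_, (gcomp h α x).2, rfl⟩
  · rintro α _ ⟨x, hx, rfl⟩
    exact congrArg S.mkQ (congrArg Subtype.val (gcomp_of_mem h hx))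
  · rintro α β hne _ ⟨x, hx, rfl⟩
    exact (congrArg S.mkQ (congrArg Subtype.val (gcomp_of_mem_ne h hx hne))).trans (map_zero _)
  · intro x
    obtain ⟨x, rfl⟩ := S.mkQ_surjective x
    exact (map_sum S.mkQ _ _).symm.trans (congrArg S.mkQ (sum_gcomp h x))

end Homogeneous

namespace LieSuperalgebra

/-- A homogeneous submodule closed under the bracket is a Lie superalgebra. -/
noncomputable def sub (L : LieSuperalgebra K) (S : Submodule K L.carrier)
    (hS : IsHomogeneousSub L.isInternal S) (hbr : ∀ x ∈ S, ∀ y ∈ S, L.bracket x y ∈ S) :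
    LieSuperalgebra K where
  carrier := S
  grading := gradeSub L.grading S
  isInternal := isInternal_gradeSub L.isInternal hS
  bracket := LinearMap.mk₂ K (fun x y => ⟨L.bracket x.1 y.1, hbr _ x.2 _ y.2⟩)
    (fun _ _ _ => Subtype.ext (by simp)) (fun _ _ _ => Subtype.ext (by simp))
    (fun _ _ _ => Subtype.ext (by simp)) (fun _ _ _ => Subtype.ext (by simp))
  bracket_grading α β x y hx hy := L.bracket_grading α β x.1 y.1 hx hy
  super_skew α β x y hx hy := Subtype.ext (L.super_skew α β x.1 y.1 hx hy)
  super_jacobi α β x y hx hy z := Subtype.ext (L.super_jacobi α β x.1 y.1 hx hy z.1)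
  bracket_self_even x hx := Subtype.ext (L.bracket_self_even x.1 hx)

/-- The quotient of a Lie superalgebra by a homogeneous ideal. -/
noncomputable def quot (L : LieSuperalgebra K) (S : Submodule K L.carrier)
    (hS : IsHomogeneousSub L.isInternal S) (hl : ∀ x ∈ S, ∀ y, L.bracket x y ∈ S)
    (hr : ∀ x, ∀ y ∈ S, L.bracket x y ∈ S) : LieSuperalgebra K where
  carrier := L.carrier ⧸ S
  grading := gradeQuot L.grading S
  isInternal := isInternal_gradeQuot L.isInternal hS
  bracket := S.liftQ
    { toFun := fun x => S.mapQ S (L.bracket x) (hr x)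
      map_add' := fun x y => by ext; simp
      map_smul' := fun c x => by ext; simp }
    (fun x hx => by
      ext y
      simpa using hl x hx y)
  bracket_grading := by
    rintro α β _ _ ⟨x, hx, rfl⟩ ⟨y, hy, rfl⟩
    exact ⟨_, L.bracket_grading α β x y hx hy, rfl⟩
  super_skew := by
    rintro α β _ _ ⟨x, hx, rfl⟩ ⟨y, hy, rfl⟩
    exact congrArg S.mkQ (L.super_skew α β x y hx hy)
  super_jacobi := by
    rintro α β _ _ ⟨x, hx, rfl⟩ ⟨y, hy, rfl⟩ z
    obtain ⟨z, rfl⟩ := S.mkQ_surjective z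
    exact congrArg S.mkQ (L.super_jacobi α β x y hx hy z)
  bracket_self_even := by
    rintro _ ⟨x, hx, rfl⟩
    exact congrArg S.mkQ (L.bracket_self_even x hx)

theorem exists_quot (L : LieSuperalgebra K) (S : Submodule K L.carrier)
    (hS : IsHomogeneousSub L.isInternal S) (hl : ∀ x ∈ S, ∀ y, L.bracket x y ∈ S)
    (hr : ∀ x, ∀ y ∈ S, L.bracket x y ∈ S) :
    ∃ (Q : LieSuperalgebra K) (q : LieSuperHom L Q), LinearMap.ker q.toLinear = S :=
  ⟨L.quot S hS hl hr, ⟨S.mkQ, fun _ x hx => ⟨x, hx, rfl⟩, fun _ _ => rfl⟩, S.ker_mkQ⟩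

end LieSuperalgebra

section Tensor

variable {M N : LieSuperalgebra K} {aMN : LieSuperAction M N} {aNM : LieSuperAction N M}

namespace TensorData

variable {Q : LieSuperalgebra K}

theorem pair_zero_left (d : TensorData aMN aNM Q) (α β : ZMod 2) (n : N.grading β) :
    d.pair α β 0 n = 0 := by
  simpa using d.pair_smul_left α β 0 0 n

theorem pair_zero_right (d : TensorData aMN aNM Q) (α β : ZMod 2) (m : M.grading α) :
    d.pair α β m 0 = 0 := by
  simpa using d.pair_smul_right α β 0 m 0

/-- The bilinear extension of tensor symbols to non-homogeneous elements. -/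
noncomputable def bil (d : TensorData aMN aNM Q) : M.carrier →ₗ[K] N.carrier →ₗ[K] Q.carrier :=
  LinearMap.mk₂ K
    (fun x y => ∑ α, ∑ β, d.pair α β (gcomp M.isInternal α x) (gcomp N.isInternal β y))
    (fun _ _ _ => by simp only [map_add, pair_add_left, Finset.sum_add_distrib])
    (fun _ _ _ => by simp only [map_smul, pair_smul_left, Finset.smul_sum])
    (fun _ _ _ => by simp only [map_add, pair_add_right, Finset.sum_add_distrib])
    (fun _ _ _ => by simp only [map_smul, pair_smul_right, Finset.smul_sum])

theorem bil_of_mem (d : TensorData aMN aNM Q) {α β : ZMod 2} {x : M.carrier} {y : N.carrier}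
    (hx : x ∈ M.grading α) (hy : y ∈ N.grading β) :
    d.bil x y = d.pair α β ⟨x, hx⟩ ⟨y, hy⟩ := by
  simp only [bil, LinearMap.mk₂_apply]
  rw [Finset.sum_eq_single α, Finset.sum_eq_single β, gcomp_of_mem _ hx, gcomp_of_mem _ hy]
  · intro β' _ hne
    rw [gcomp_of_mem_ne _ hy hne.symm, pair_zero_right]
  · simp
  · intro α' _ hne
    simp only [gcomp_of_mem_ne _ hx hne.symm, pair_zero_left, Finset.sum_const_zero]
  · simp

theorem pair_eq_bil (d : TensorData aMN aNM Q) (α β : ZMod 2) (x : M.grading α)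
    (y : N.grading β) : d.pair α β x y = d.bil x y :=
  (d.bil_of_mem x.2 y.2).symm

theorem bil_grading (d : TensorData aMN aNM Q) {α β : ZMod 2} {x : M.carrier} {y : N.carrier}
    (hx : x ∈ M.grading α) (hy : y ∈ N.grading β) : d.bil x y ∈ Q.grading (α + β) := by
  rw [d.bil_of_mem hx hy]
  exact d.pair_grading ..

theorem bil_bracket_left (d : TensorData aMN aNM Q) {α α' β : ZMod 2} {m m' : M.carrier}
    {n : N.carrier} (hm : m ∈ M.grading α) (hm' : m' ∈ M.grading α') (hn : n ∈ N.grading β) :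
    d.bil (M.bracket m m') n
      = d.bil m (aMN.act m' n) - ssign α α' • d.bil m' (aMN.act m n) := by
  simpa only [pair_eq_bil] using d.pair_bracket_left α α' β ⟨m, hm⟩ ⟨m', hm'⟩ ⟨n, hn⟩

theorem bil_bracket_right (d : TensorData aMN aNM Q) {α β β' : ZMod 2} {m : M.carrier}
    {n n' : N.carrier} (hm : m ∈ M.grading α) (hn : n ∈ N.grading β) (hn' : n' ∈ N.grading β') :
    d.bil m (N.bracket n n')
      = ssign β' (α + β) • d.bil (aNM.act n' m) n - ssign α β • d.bil (aNM.act n m) n' := by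
  simpa only [pair_eq_bil] using d.pair_bracket_right α β β' ⟨m, hm⟩ ⟨n, hn⟩ ⟨n', hn'⟩

theorem bil_bracket_bil (d : TensorData aMN aNM Q) {α β α' β' : ZMod 2} {m m' : M.carrier}
    {n n' : N.carrier} (hm : m ∈ M.grading α) (hn : n ∈ N.grading β) (hm' : m' ∈ M.grading α')
    (hn' : n' ∈ N.grading β') :
    Q.bracket (d.bil m n) (d.bil m' n')
      = -(ssign α β • d.bil (aNM.act n m) (aMN.act m' n')) := by
  simpa only [pair_eq_bil] using
    d.pair_bracket_pair α β α' β' ⟨m, hm⟩ ⟨n, hn⟩ ⟨m', hm'⟩ ⟨n', hn'⟩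

/-- Tensor symbols from a bilinear map satisfying the relations on homogeneous elements. -/
def ofBil (B : M.carrier →ₗ[K] N.carrier →ₗ[K] Q.carrier)
    (grading : ∀ (α β : ZMod 2), ∀ m ∈ M.grading α, ∀ n ∈ N.grading β, B m n ∈ Q.grading (α + β))
    (left : ∀ (α α' β : ZMod 2), ∀ m ∈ M.grading α, ∀ m' ∈ M.grading α', ∀ n ∈ N.grading β,
      B (M.bracket m m') n = B m (aMN.act m' n) - ssign α α' • B m' (aMN.act m n))
    (right : ∀ (α β β' : ZMod 2), ∀ m ∈ M.grading α, ∀ n ∈ N.grading β, ∀ n' ∈ N.grading β',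
      B m (N.bracket n n')
        = ssign β' (α + β) • B (aNM.act n' m) n - ssign α β • B (aNM.act n m) n')
    (both : ∀ (α β α' β' : ZMod 2), ∀ m ∈ M.grading α, ∀ n ∈ N.grading β,
      ∀ m' ∈ M.grading α', ∀ n' ∈ N.grading β',
      Q.bracket (B m n) (B m' n') = -(ssign α β • B (aNM.act n m) (aMN.act m' n'))) :
    TensorData aMN aNM Q where
  pair _ _ m n := B m.1 n.1
  pair_grading α β m n := grading α β m.1 m.2 n.1 n.2
  pair_smul_left _ _ c m n := by simp
  pair_smul_right _ _ c m n := by simp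
  pair_add_left _ _ m m' n := by simp
  pair_add_right _ _ m n n' := by simp
  pair_bracket_left α α' β m m' n := left α α' β m.1 m.2 m'.1 m'.2 n.1 n.2
  pair_bracket_right α β β' m n n' := right α β β' m.1 m.2 n.1 n.2 n'.1 n'.2
  pair_bracket_pair α β α' β' m n m' n' :=
    both α β α' β' m.1 m.2 n.1 n.2 m'.1 m'.2 n'.1 n'.2

end TensorData

theorem bilinear_mem_of_homogeneous {U : Type} [AddCommGroup U] [Module K U]
    {V W : Type} [AddCommGroup V] [Module K V] [AddCommGroup W] [Module K W]
    {g : ZMod 2 → Submodule K V} {g' : ZMod 2 → Submodule K W}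
    (h : DirectSum.IsInternal g) (h' : DirectSum.IsInternal g')
    (B : V →ₗ[K] W →ₗ[K] U) (S : Submodule K U)
    (hB : ∀ α β, ∀ x ∈ g α, ∀ y ∈ g' β, B x y ∈ S) (x : V) (y : W) : B x y ∈ S := by
  induction x using homogeneous_induction h with
  | hom α x hx =>
    induction y using homogeneous_induction h' with
    | hom β y hy => exact hB α β x hx y hy
    | add y z hy hz => simpa using add_mem hy hz
  | add x z hx hz => simpa using add_mem hx hz

/-- The non-abelian tensor product is linearly spanned by the tensor symbols. -/
theorem IsNATensor.span_eq_top {T : LieSuperalgebra K} {ι : TensorData aMN aNM T}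
    (h : IsNATensor aMN aNM T ι) :
    Submodule.span K {t | ∃ m n, ι.bil m n = t} = ⊤ := by
  set s : Set T.carrier := {t | ∃ α β, ∃ m ∈ M.grading α, ∃ n ∈ N.grading β, ι.bil m n = t}
  have hom : IsHomogeneousSub T.isInternal (Submodule.span K s) := by
    apply isHomogeneousSub_span
    rintro _ ⟨α, β, m, hm, n, hn, rfl⟩
    exact ⟨_, ι.bil_grading hm hn⟩
  have mem : ∀ m n, ι.bil m n ∈ Submodule.span K s :=
    bilinear_mem_of_homogeneous M.isInternal N.isInternal _ _
      fun α β m hm n hn => Submodule.subset_span ⟨α, β, m, hm, n, hn, rfl⟩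
  have closed : ∀ x ∈ Submodule.span K s, ∀ y ∈ Submodule.span K s,
      T.bracket x y ∈ Submodule.span K s := by
    intro x hx y hy
    induction hx, hy using Submodule.span_induction₂ with
    | mem_mem x y hx hy =>
      obtain ⟨α, β, m, hm, n, hn, rfl⟩ := hx
      obtain ⟨α', β', m', hm', n', hn', rfl⟩ := hy
      rw [ι.bil_bracket_bil hm hn hm' hn']
      exact neg_mem (zsmul_mem (mem _ _) _)
    | zero_left => simp
    | zero_right => simp
    | add_left x y z _ _ _ hx hy => simpa using add_mem hx hy
    | add_right x y z _ _ _ hx hy => simpa using add_mem hx hy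
    | smul_left c x y _ _ hx => simpa using Submodule.smul_mem _ c hx
    | smul_right c x y _ _ hx => simpa using Submodule.smul_mem _ c hx
  let S := T.sub (Submodule.span K s) hom closed
  let B : M.carrier →ₗ[K] N.carrier →ₗ[K] S.carrier :=
    LinearMap.mk₂ K (fun m n => (⟨ι.bil m n, mem m n⟩ : Submodule.span K s))
      (fun m m' n => Subtype.ext (LinearMap.map_add₂ ι.bil m m' n))
      (fun c m n => Subtype.ext (LinearMap.map_smul₂ ι.bil c m n))
      (fun m n n' => Subtype.ext (map_add (ι.bil m) n n'))
      (fun c m n => Subtype.ext (map_smul (ι.bil m) c n))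
  let d : TensorData aMN aNM S := TensorData.ofBil B
    (fun α β m hm n hn => ι.bil_grading hm hn)
    (fun α α' β m hm m' hm' n hn => Subtype.ext (ι.bil_bracket_left hm hm' hn))
    (fun α β β' m hm n hn n' hn' => Subtype.ext (ι.bil_bracket_right hm hn hn'))
    (fun α β α' β' m hm n hn m' hm' n' hn' => Subtype.ext (ι.bil_bracket_bil hm hn hm' hn'))
  obtain ⟨f, hf, -⟩ := h S d
  obtain ⟨e, -, he⟩ := h T ι
  let f' : LieSuperHom T T :=
    { toLinear := (Submodule.span K s).subtype ∘ₗ f.toLinear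
      map_grading := fun α x hx => f.map_grading α x hx
      map_bracket := fun x y => congrArg Subtype.val (f.map_bracket x y) }
  have h1 : f' = e := he f' fun α β m n =>
    (congrArg Subtype.val (hf α β m n)).trans (ι.bil_of_mem m.2 n.2)
  have h2 : (⟨LinearMap.id, fun _ _ hx => hx, fun _ _ => rfl⟩ : LieSuperHom T T) = e :=
    he _ fun _ _ _ _ => rfl
  rw [eq_top_iff]
  intro x _
  have hx : x = (f.toLinear x : Submodule.span K s).1 :=
    congrArg (fun k : LieSuperHom T T => k.toLinear x) (h2.trans h1.symm)
  rw [hx]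
  refine Submodule.span_mono ?_ (f.toLinear x : Submodule.span K s).2
  rintro _ ⟨α, β, m, hm, n, hn, rfl⟩
  exact ⟨m, n, rfl⟩

theorem IsNATensor.linearMap_ext {T : LieSuperalgebra K} {ι : TensorData aMN aNM T}
    (h : IsNATensor aMN aNM T ι) {U : Type} [AddCommGroup U] [Module K U]
    {f f' : T.carrier →ₗ[K] U} (hf : ∀ m n, f (ι.bil m n) = f' (ι.bil m n)) : f = f' := by
  apply LinearMap.ext_on h.span_eq_top
  rintro _ ⟨m, n, rfl⟩
  exact hf m n

theorem bilinear_ext_of_homogeneous {U : Type} [AddCommGroup U] [Module K U]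
    {V W : Type} [AddCommGroup V] [Module K V] [AddCommGroup W] [Module K W]
    {g : ZMod 2 → Submodule K V} {g' : ZMod 2 → Submodule K W}
    (h : DirectSum.IsInternal g) (h' : DirectSum.IsInternal g')
    {B B' : V →ₗ[K] W →ₗ[K] U}
    (hB : ∀ α β, ∀ x ∈ g α, ∀ y ∈ g' β, B x y = B' x y) (x : V) (y : W) : B x y = B' x y := by
  have := bilinear_mem_of_homogeneous h h' (B - B') ⊥
    (fun α β x hx y hy => by simp [hB α β x hx y hy]) x y
  simpa [sub_eq_zero] using this

end Tensor

section RightExact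

variable {P M N : LieSuperalgebra K} {aPM : LieSuperAction P M} {aMP : LieSuperAction M P}
  {aPN : LieSuperAction P N} {aNP : LieSuperAction N P}
  {T₂ : LieSuperalgebra K} {ι₂ : TensorData aPM aMP T₂}
  {T₃ : LieSuperalgebra K} {ι₃ : TensorData aPN aNP T₃}

/-- Functoriality of the non-abelian tensor product in its second argument. -/
theorem IsNATensor.exists_map (h₂ : IsNATensor aPM aMP T₂ ι₂) (ι₃ : TensorData aPN aNP T₃)
    (φ : LieSuperHom M N)
    (hl : ∀ p m, φ.toLinear (aPM.act p m) = aPN.act p (φ.toLinear m))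
    (hr : ∀ m p, aNP.act (φ.toLinear m) p = aMP.act m p) :
    ∃ F : LieSuperHom T₂ T₃,
      ∀ p m, F.toLinear (ι₂.bil p m) = ι₃.bil p (φ.toLinear m) := by
  obtain ⟨F, hF, -⟩ := h₂ T₃ (TensorData.ofBil (ι₃.bil.compl₂ φ.toLinear)
    (fun α β m hm n hn => ι₃.bil_grading hm (φ.map_grading _ _ hn))
    (fun α α' β m hm m' hm' n hn => by
      simpa only [LinearMap.compl₂_apply, hl] using
        ι₃.bil_bracket_left hm hm' (φ.map_grading _ _ hn))
    (fun α β β' m hm n hn n' hn' => by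
      simpa only [LinearMap.compl₂_apply, hr, φ.map_bracket] using
        ι₃.bil_bracket_right hm (φ.map_grading _ _ hn) (φ.map_grading _ _ hn'))
    (fun α β α' β' m hm n hn m' hm' n' hn' => by
      simpa only [LinearMap.compl₂_apply, hl, hr] using
        ι₃.bil_bracket_bil hm (φ.map_grading _ _ hn) hm' (φ.map_grading _ _ hn')))
  refine ⟨F, bilinear_ext_of_homogeneous P.isInternal M.isInternal
    (B := ι₂.bil.compr₂ F.toLinear) (B' := ι₃.bil.compl₂ φ.toLinear) ?_⟩
  intro α β p hp m hm
  rw [LinearMap.compr₂_apply, ι₂.bil_of_mem hp hm, hF]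
  rfl

/-- When `P` and the kernel of `φ` act trivially on each other, the kernel of `P ⊗ φ` is spanned
by the symbols `p ⊗ k` with `k` in the kernel of `φ`. -/
theorem IsNATensor.ker_map_le (h₂ : IsNATensor aPM aMP T₂ ι₂) (h₃ : IsNATensor aPN aNP T₃ ι₃)
    (φ : LieSuperHom M N) (hsurj : Function.Surjective φ.toLinear)
    (hl : ∀ p m, φ.toLinear (aPM.act p m) = aPN.act p (φ.toLinear m))
    (hr : ∀ m p, aNP.act (φ.toLinear m) p = aMP.act m p)
    (hk : ∀ p m, φ.toLinear m = 0 → aPM.act p m = 0)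
    (F : T₂.carrier →ₗ[K] T₃.carrier)
    (hF : ∀ p m, F (ι₂.bil p m) = ι₃.bil p (φ.toLinear m)) :
    LinearMap.ker F ≤ Submodule.span K {t | ∃ p k, φ.toLinear k = 0 ∧ ι₂.bil p k = t} := by
  have hk' : ∀ p m, φ.toLinear m = 0 → aMP.act m p = 0 := fun p m hm => by
    rw [← hr, hm, map_zero, LinearMap.zero_apply]
  set s : Set T₂.carrier := {t | ∃ α β, ∃ p ∈ P.grading α, ∃ k ∈ M.grading β,
    φ.toLinear k = 0 ∧ ι₂.bil p k = t} with hs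
  set S := Submodule.span K s with hS
  have hom : IsHomogeneousSub T₂.isInternal S := by
    apply isHomogeneousSub_span
    rintro _ ⟨α, β, m, hm, n, hn, -, rfl⟩
    exact ⟨_, ι₂.bil_grading hm hn⟩
  have mem : ∀ p k, φ.toLinear k = 0 → ι₂.bil p k ∈ S := by
    intro p k hk0
    induction p using homogeneous_induction P.isInternal with
    | hom α p hp =>
      rw [← sum_gcomp M.isInternal k, map_sum]
      refine Submodule.sum_mem _ fun β _ =>
        Submodule.subset_span ⟨α, β, p, hp, _, (gcomp M.isInternal β k).2, ?_, rfl⟩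
      rw [← gcomp_map M.isInternal N.isInternal φ.toLinear φ.map_grading, hk0]
      simp
    | add p p' h h' => simpa using add_mem h h'
  have brl : ∀ x ∈ S, ∀ y, T₂.bracket x y ∈ S := by
    suffices S ≤ LinearMap.ker T₂.bracket by
      intro x hx y
      rw [LinearMap.mem_ker.mp (this hx)]
      simp
    rw [hS, Submodule.span_le]
    rintro _ ⟨α, β, p, hp, k, hkm, hk0, rfl⟩
    refine LinearMap.mem_ker.mpr (h₂.linearMap_ext fun p' m' => ?_)
    have := bilinear_ext_of_homogeneous P.isInternal M.isInternal
      (B := ι₂.bil.compr₂ (T₂.bracket (ι₂.bil p k))) (B' := 0) (fun α' β' p' hp' m' hm' => by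
        simp [ι₂.bil_bracket_bil hp hkm hp' hm', hk' _ _ hk0]) p' m'
    simpa using this
  have brr : ∀ x, ∀ y ∈ S, T₂.bracket x y ∈ S := by
    suffices S ≤ LinearMap.ker T₂.bracket.flip by
      intro x y hy
      rw [← LinearMap.flip_apply, LinearMap.mem_ker.mp (this hy)]
      simp
    rw [hS, Submodule.span_le]
    rintro _ ⟨α, β, p, hp, k, hkm, hk0, rfl⟩
    refine LinearMap.mem_ker.mpr (h₂.linearMap_ext fun p' m' => ?_)
    have := bilinear_ext_of_homogeneous P.isInternal M.isInternal
      (B := ι₂.bil.compr₂ (T₂.bracket.flip (ι₂.bil p k))) (B' := 0)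
      (fun α' β' p' hp' m' hm' => by
        simp [ι₂.bil_bracket_bil hp' hm' hp hkm, hk _ _ hk0]) p' m'
    simpa using this
  obtain ⟨Q, q, hq⟩ := T₂.exists_quot S hom brl brr
  let B₀ : M.carrier →ₗ[K] P.carrier →ₗ[K] Q.carrier := (ι₂.bil.compr₂ q.toLinear).flip
  have hB₀ : LinearMap.ker φ.toLinear ≤ LinearMap.ker B₀ := by
    intro k hk0
    refine LinearMap.mem_ker.mpr (LinearMap.ext fun p => ?_)
    have := mem p k hk0
    rw [← hq] at this
    simpa [B₀] using this
  let B : P.carrier →ₗ[K] N.carrier →ₗ[K] Q.carrier :=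
    ((LinearMap.ker φ.toLinear).liftQ B₀ hB₀ ∘ₗ
      (φ.toLinear.quotKerEquivOfSurjective hsurj).symm.toLinearMap).flip
  have hB : ∀ p m, B p (φ.toLinear m) = q.toLinear (ι₂.bil p m) := by
    intro p m
    have : (φ.toLinear.quotKerEquivOfSurjective hsurj).symm (φ.toLinear m)
        = (LinearMap.ker φ.toLinear).mkQ m := by
      rw [LinearEquiv.symm_apply_eq]
      rfl
    simp only [B, LinearMap.flip_apply, LinearMap.comp_apply, LinearEquiv.coe_coe, this]
    rfl
  have lift : ∀ β, ∀ n ∈ N.grading β, ∃ m ∈ M.grading β, φ.toLinear m = n := by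
    intro β n hn
    obtain ⟨m, rfl⟩ := hsurj n
    refine ⟨gcomp M.isInternal β m, (gcomp M.isInternal β m).2, ?_⟩
    rw [← gcomp_map M.isInternal N.isInternal φ.toLinear φ.map_grading,
      gcomp_of_mem N.isInternal hn]
  let d : TensorData aPN aNP Q := TensorData.ofBil (Q := Q) B
    (by
      intro α β p hp n hn
      obtain ⟨m, hm, rfl⟩ := lift β n hn
      rw [hB]
      exact q.map_grading _ _ (ι₂.bil_grading hp hm))
    (by
      intro α α' β p hp p' hp' n hn
      obtain ⟨m, hm, rfl⟩ := lift β n hn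
      simp only [← hl, hB, ι₂.bil_bracket_left hp hp' hm, map_sub, map_zsmul])
    (by
      intro α β β' p hp n hn n' hn'
      obtain ⟨m, hm, rfl⟩ := lift β n hn
      obtain ⟨m', hm', rfl⟩ := lift β' n' hn'
      simp only [← φ.map_bracket, hr, hB, ι₂.bil_bracket_right hp hm hm', map_sub, map_zsmul])
    (by
      intro α β α' β' p hp n hn p' hp' n' hn'
      obtain ⟨m, hm, rfl⟩ := lift β n hn
      obtain ⟨m', hm', rfl⟩ := lift β' n' hn'
      simp only [← hl, hr, hB, ← q.map_bracket, ι₂.bil_bracket_bil hp hm hp' hm', map_neg,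
        map_zsmul])
  obtain ⟨G, hG, -⟩ := h₃ Q d
  have hGB : ∀ p n, G.toLinear (ι₃.bil p n) = B p n :=
    bilinear_ext_of_homogeneous P.isInternal N.isInternal
      (B := ι₃.bil.compr₂ G.toLinear) (B' := B) fun α β p hp n hn => by
        rw [LinearMap.compr₂_apply, ι₃.bil_of_mem hp hn, hG]
        rfl
  have hGF : G.toLinear ∘ₗ F = q.toLinear := h₂.linearMap_ext fun p m => by
    rw [LinearMap.comp_apply, hF, hGB, hB]
  intro x hx
  have hxS : x ∈ S := by
    rw [← hq, LinearMap.mem_ker, ← hGF, LinearMap.comp_apply, LinearMap.mem_ker.mp hx, map_zero]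
  refine Submodule.span_mono ?_ hxS
  rintro _ ⟨α, β, p, -, k, -, hk0, rfl⟩
  exact ⟨p, k, hk0, rfl⟩

end RightExact

section Snake

variable {P M N : LieSuperalgebra K} {aPM : LieSuperAction P M} {aMP : LieSuperAction M P}
  {aPN : LieSuperAction P N} {aNP : LieSuperAction N P}
  {T₂ : LieSuperalgebra K} {ι₂ : TensorData aPM aMP T₂}
  {T₃ : LieSuperalgebra K} {ι₃ : TensorData aPN aNP T₃}

theorem TensorData.linearMap_bil {aPM : LieSuperAction P M} {aMP : LieSuperAction M P}
    {Q : LieSuperalgebra K} (d : TensorData aPM aMP Q) {U : Type} [AddCommGroup U] [Module K U]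
    (ν : Q.carrier →ₗ[K] U) (f : P.carrier →ₗ[K] M.carrier →ₗ[K] U)
    (h : ∀ (α β : ZMod 2) (p : P.grading α) (m : M.grading β), ν (d.pair α β p m) = f p.1 m.1)
    (p : P.carrier) (m : M.carrier) : ν (d.bil p m) = f p m :=
  bilinear_ext_of_homogeneous P.isInternal M.isInternal (B := d.bil.compr₂ ν) (B' := f)
    (fun α β p hp m hm => by rw [LinearMap.compr₂_apply, d.bil_of_mem hp hm, h]) p m

/-- The map `P ⊗ φ` together with the connecting map `σ` of the snake lemma. -/
theorem IsNATensor.exists_connecting (h₂ : IsNATensor aPM aMP T₂ ι₂)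
    (h₃ : IsNATensor aPN aNP T₃ ι₃)
    (φ : LieSuperHom M N) (hsurj : Function.Surjective φ.toLinear)
    (hl : ∀ p m, φ.toLinear (aPM.act p m) = aPN.act p (φ.toLinear m))
    (hr : ∀ m p, aNP.act (φ.toLinear m) p = aMP.act m p)
    (hk : ∀ p m, φ.toLinear m = 0 → aPM.act p m = 0)
    (ν₂ : T₂.carrier →ₗ[K] M.carrier) (hν₂ : ∀ p m, ν₂ (ι₂.bil p m) = aPM.act p m)
    (ν₃ : T₃.carrier →ₗ[K] N.carrier) (hν₃ : ∀ p n, ν₃ (ι₃.bil p n) = aPN.act p n) :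
    ∃ (F : T₂.carrier →ₗ[K] T₃.carrier) (σ : T₃.carrier →ₗ[K] M.carrier),
      Function.Surjective F ∧
      LinearMap.ker F = Submodule.span K {t | ∃ p k, φ.toLinear k = 0 ∧ ι₂.bil p k = t} ∧
      (∀ t, σ (F t) = ν₂ t) ∧ (∀ t, φ.toLinear (σ t) = ν₃ t) := by
  obtain ⟨F, hF⟩ := h₂.exists_map ι₃ φ hl hr
  have hFs : Function.Surjective F.toLinear := by
    rw [← LinearMap.range_eq_top, eq_top_iff, ← h₃.span_eq_top, Submodule.span_le]
    rintro _ ⟨p, n, rfl⟩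
    obtain ⟨m, rfl⟩ := hsurj n
    exact ⟨_, hF p m⟩
  have hker : LinearMap.ker F.toLinear
      = Submodule.span K {t | ∃ p k, φ.toLinear k = 0 ∧ ι₂.bil p k = t} := by
    refine le_antisymm (h₂.ker_map_le h₃ φ hsurj hl hr hk F.toLinear hF) ?_
    rw [Submodule.span_le]
    rintro _ ⟨p, k, hk0, rfl⟩
    simp [hF, hk0]
  have hν : LinearMap.ker F.toLinear ≤ LinearMap.ker ν₂ := by
    rw [hker, Submodule.span_le]
    rintro _ ⟨p, k, hk0, rfl⟩
    simp [hν₂, hk _ _ hk0]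
  let σ := (LinearMap.ker F.toLinear).liftQ ν₂ hν ∘ₗ
    (F.toLinear.quotKerEquivOfSurjective hFs).symm.toLinearMap
  have hσ : ∀ t, σ (F.toLinear t) = ν₂ t := by
    intro t
    have : (F.toLinear.quotKerEquivOfSurjective hFs).symm (F.toLinear t)
        = (LinearMap.ker F.toLinear).mkQ t := by
      rw [LinearEquiv.symm_apply_eq]
      rfl
    simp only [σ, LinearMap.comp_apply, LinearEquiv.coe_coe, this]
    rfl
  refine ⟨F.toLinear, σ, hFs, hker, hσ, fun t => ?_⟩
  have : φ.toLinear ∘ₗ σ = ν₃ := h₃.linearMap_ext fun p n => by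
    obtain ⟨m, rfl⟩ := hsurj n
    rw [LinearMap.comp_apply, ← hF, hσ, hν₂, hl, hF, hν₃]
  rw [← this]
  rfl

end Snake

section Commutator

variable {A : AssocSuperalgebra K} {brA : A.carrier →ₗ[K] A.carrier →ₗ[K] A.carrier}
  {c : A.carrier ⊗[K] A.carrier →ₗ[K] A.carrier}

theorem tensor_mem_of_homogeneous {U : Type} [AddCommGroup U] [Module K U]
    {V W : Type} [AddCommGroup V] [Module K V] [AddCommGroup W] [Module K W]
    {g : ZMod 2 → Submodule K V} {g' : ZMod 2 → Submodule K W}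
    (h : DirectSum.IsInternal g) (h' : DirectSum.IsInternal g')
    (f : V ⊗[K] W →ₗ[K] U) (S : Submodule K U)
    (hf : ∀ α β, ∀ x ∈ g α, ∀ y ∈ g' β, f (x ⊗ₜ[K] y) ∈ S) (w : V ⊗[K] W) : f w ∈ S := by
  induction w using TensorProduct.induction_on with
  | zero => simp
  | tmul x y =>
    exact bilinear_mem_of_homogeneous h h' ((TensorProduct.mk K V W).compr₂ f) S hf x y
  | add w w' hw hw' => simpa using add_mem hw hw'

theorem tmul_sub_zsmul {V W : Type} [AddCommGroup V] [Module K V] [AddCommGroup W] [Module K W]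
    (v : V) (x y : W) (n : ℤ) : v ⊗ₜ[K] (x - n • y) = v ⊗ₜ[K] x - n • (v ⊗ₜ[K] y) := by
  rw [← TensorProduct.mk_apply, map_sub, map_zsmul]
  rfl

theorem commutator_mem_commSpan (B : NuAssocSuperalgebra K) {α β : ZMod 2} (a : B.grading α)
    (b : B.grading β) : a.1 * b.1 - ssign α β • (b.1 * a.1) ∈ commSpan B :=
  Submodule.subset_span ⟨α, β, a, b, rfl⟩

theorem tmul_commutator_mem_JA (B : NuAssocSuperalgebra K) {α β γ : ZMod 2} (a : B.grading α)
    (b : B.grading β) (d : B.grading γ) :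
    a.1 ⊗ₜ[K] (b.1 * d.1) - ssign β γ • (a.1 ⊗ₜ[K] (d.1 * b.1)) ∈ JA B :=
  Submodule.subset_span (Or.inr ⟨α, β, γ, a, b, d, rfl⟩)

theorem map_mem_commSpan
    (hbrA : ∀ (α β : ZMod 2) (a : A.grading α) (b : A.grading β),
      brA a.1 b.1 = a.1 * b.1 - ssign α β • (b.1 * a.1))
    (hc : ∀ a b : A.carrier, c (a ⊗ₜ[K] b) = brA a b) (w : A.carrier ⊗[K] A.carrier) :
    c w ∈ commSpan A.toNu := by
  have h := fun S : Submodule K A.carrier => tensor_mem_of_homogeneous A.isInternal A.isInternal c S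
  refine h (commSpan A.toNu) (fun α β a ha b hb => ?_) w
  rw [hc, hbrA α β ⟨a, ha⟩ ⟨b, hb⟩]
  exact commutator_mem_commSpan A.toNu ⟨a, ha⟩ ⟨b, hb⟩

theorem exists_of_mem_commSpan
    (hbrA : ∀ (α β : ZMod 2) (a : A.grading α) (b : A.grading β),
      brA a.1 b.1 = a.1 * b.1 - ssign α β • (b.1 * a.1))
    (hc : ∀ a b : A.carrier, c (a ⊗ₜ[K] b) = brA a b) {x : A.carrier}
    (hx : x ∈ commSpan A.toNu) : ∃ w, c w = x := by
  suffices h : commSpan A.toNu ≤ LinearMap.range c from h hx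
  refine Submodule.span_le.mpr ?_
  rintro _ ⟨α, β, a, b, rfl⟩
  exact ⟨a.1 ⊗ₜ[K] b.1, (hc _ _).trans (hbrA α β a b)⟩

theorem IA_le_JA : IA A.toNu ≤ JA A.toNu :=
  Submodule.span_mono Set.subset_union_left

theorem JA_eq_sup
    (hbrA : ∀ (α β : ZMod 2) (a : A.grading α) (b : A.grading β),
      brA a.1 b.1 = a.1 * b.1 - ssign α β • (b.1 * a.1))
    (hc : ∀ a b : A.carrier, c (a ⊗ₜ[K] b) = brA a b) :
    JA A.toNu = IA A.toNu ⊔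
      Submodule.span K {t : A.carrier ⊗[K] A.carrier | ∃ a w, a ⊗ₜ[K] c w = t} := by
  apply le_antisymm
  · rw [JA, Submodule.span_union]
    refine sup_le_sup le_rfl (Submodule.span_mono ?_)
    rintro _ ⟨α, β, γ, a, b, d, rfl⟩
    refine ⟨a.1, b.1 ⊗ₜ[K] d.1, ?_⟩
    exact (congrArg (TensorProduct.mk K A.carrier A.carrier a.1)
      ((hc b.1 d.1).trans (hbrA β γ b d))).trans (tmul_sub_zsmul _ _ _ _)
  · refine sup_le IA_le_JA (Submodule.span_le.mpr ?_)
    rintro _ ⟨a, w, rfl⟩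
    have h : ∀ S : Submodule K (A.carrier ⊗[K] A.carrier),
        (∀ α β γ, ∀ a ∈ A.grading α, ∀ b ∈ A.grading β, ∀ d ∈ A.grading γ,
          a ⊗ₜ[K] brA b d ∈ S) → ∀ a w, a ⊗ₜ[K] c w ∈ S := by
      intro S hS a w
      induction a using homogeneous_induction A.isInternal with
      | hom α a ha =>
        exact tensor_mem_of_homogeneous A.isInternal A.isInternal
          (TensorProduct.mk K A.carrier A.carrier a ∘ₗ c) S
          (fun β γ b hb d hd => by simpa [hc] using hS α β γ a ha b hb d hd) w
      | add a a' h h' =>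
        rw [TensorProduct.add_tmul]
        exact add_mem h h'
    refine h (JA A.toNu) (fun α β γ a ha b hb d hd => ?_) a w
    rw [hbrA β γ ⟨b, hb⟩ ⟨d, hd⟩, tmul_sub_zsmul]
    exact tmul_commutator_mem_JA A.toNu ⟨a, ha⟩ ⟨b, hb⟩ ⟨d, hd⟩

theorem map_mem_grading
    (hbrA : ∀ (α β : ZMod 2) (a : A.grading α) (b : A.grading β),
      brA a.1 b.1 = a.1 * b.1 - ssign α β • (b.1 * a.1))
    (hc : ∀ a b : A.carrier, c (a ⊗ₜ[K] b) = brA a b) {γ : ZMod 2}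
    {w : A.carrier ⊗[K] A.carrier} (hw : w ∈ gradeTensor A.grading A.grading γ) :
    c w ∈ A.grading γ := by
  suffices h : gradeTensor A.grading A.grading γ ≤ (A.grading γ).comap c from h hw
  refine Submodule.span_le.mpr ?_
  rintro _ ⟨α, β, a, b, rfl, ha, hb, rfl⟩
  rw [SetLike.mem_coe, Submodule.mem_comap, hc, hbrA α β ⟨a, ha⟩ ⟨b, hb⟩]
  refine sub_mem (A.grading_mul α β a b ha hb) (zsmul_mem ?_ _)
  rw [add_comm]
  exact A.grading_mul β α b a hb ha

end Commutator

section SixTerm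

variable {V : Type} [AddCommGroup V] [Module K V] {I : Submodule K (V ⊗[K] V)}
  {C : Submodule K V} {c : V ⊗[K] V →ₗ[K] V} {cbar : (V ⊗[K] V ⧸ I) →ₗ[K] V}
  {brA : V →ₗ[K] V →ₗ[K] V} {LA VA CA : LieSuperalgebra K}
  {eA : LA.carrier ≃ₗ[K] V} {eV : VA.carrier ≃ₗ[K] (V ⊗[K] V ⧸ I)} {eC : CA.carrier ≃ₗ[K] C}

/-- The commutator map `V(A) → [A,A]`. -/
theorem exists_commutatorHom (g : ZMod 2 → Submodule K V)
    (hc : ∀ a b : V, c (a ⊗ₜ[K] b) = brA a b) (hcC : ∀ w, c w ∈ C)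
    (hcgr : ∀ γ, ∀ w ∈ gradeTensor g g γ, c w ∈ g γ)
    (hcbar : ∀ w : V ⊗[K] V, cbar (I.mkQ w) = c w)
    (hVgr : ∀ γ : ZMod 2, (VA.grading γ).map eV.toLinearMap = gradeQuot (gradeTensor g g) I γ)
    (hVbr : ∀ w w' : V ⊗[K] V,
      eV (VA.bracket (eV.symm (I.mkQ w)) (eV.symm (I.mkQ w'))) = I.mkQ ((c w) ⊗ₜ[K] (c w')))
    (hCgr : ∀ γ : ZMod 2, (CA.grading γ).map eC.toLinearMap = gradeSub g C γ)
    (hCbr : ∀ x y : CA.carrier, (eC (CA.bracket x y)).1 = brA (eC x).1 (eC y).1) :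
    ∃ φ : LieSuperHom VA CA, ∀ v, (eC (φ.toLinear v)).1 = cbar (eV v) := by
  have hmem : ∀ v, (cbar ∘ₗ eV.toLinearMap) v ∈ C := by
    intro v
    obtain ⟨w, hw⟩ := I.mkQ_surjective (eV v)
    rw [LinearMap.comp_apply, LinearEquiv.coe_coe, ← hw, hcbar]
    exact hcC w
  have heC : ∀ v, (eC (eC.symm ((cbar ∘ₗ eV.toLinearMap).codRestrict C hmem v))).1
      = cbar (eV v) := by
    intro v
    rw [eC.apply_symm_apply]
    rfl
  refine ⟨⟨eC.symm.toLinearMap ∘ₗ (cbar ∘ₗ eV.toLinearMap).codRestrict C hmem, ?_, ?_⟩, heC⟩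
  · intro γ v hv
    have h1 : eV v ∈ gradeQuot (gradeTensor g g) I γ := by
      rw [← hVgr]
      exact Submodule.mem_map_of_mem hv
    obtain ⟨w, hw, hwv⟩ := h1
    have h2 : (cbar ∘ₗ eV.toLinearMap).codRestrict C hmem v ∈ gradeSub g C γ := by
      change cbar (eV v) ∈ g γ
      rw [← hwv, hcbar]
      exact hcgr γ w hw
    rw [← hCgr] at h2
    obtain ⟨x, hx, hxv⟩ := h2
    rw [LinearMap.comp_apply, ← hxv]
    simpa using hx
  · intro v v'
    apply eC.injective
    apply Subtype.ext
    rw [hCbr]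
    simp only [LinearMap.comp_apply, LinearEquiv.coe_coe, heC]
    obtain ⟨w, hw⟩ := I.mkQ_surjective (eV v)
    obtain ⟨w', hw'⟩ := I.mkQ_surjective (eV v')
    have h := hVbr w w'
    rw [hw, hw', eV.symm_apply_apply, eV.symm_apply_apply] at h
    rw [h, hcbar, hc, ← hcbar, ← hcbar, hw, hw']

theorem exists_sixTerm {D : Submodule K V} {J : Submodule K (V ⊗[K] V)}
    (hc : ∀ a b : V, c (a ⊗ₜ[K] b) = brA a b) (hcC : ∀ w, c w ∈ C)
    (hCc : ∀ x ∈ C, ∃ w, c w = x)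
    (hCle : ∀ S : Submodule K V, (∀ α β, ∀ x ∈ LA.grading α, ∀ y ∈ LA.grading β,
      eA (LA.bracket x y) ∈ S) → C ≤ S)
    (hD : D = Submodule.span K {x | ∃ a, ∃ y ∈ C, x = brA a y})
    (hJ : J = I ⊔ Submodule.span K {t | ∃ a w, a ⊗ₜ[K] c w = t})
    (hcbar : ∀ w : V ⊗[K] V, cbar (I.mkQ w) = c w)
    (φ : LieSuperHom VA CA) (hφ : ∀ v, (eC (φ.toLinear v)).1 = cbar (eV v))
    (a1 : LieSuperAction LA VA) (a2 : LieSuperAction VA LA)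
    (ha1 : ∀ (x : LA.carrier) (w : V ⊗[K] V),
      a1.act x (eV.symm (I.mkQ w)) = eV.symm (I.mkQ ((eA x) ⊗ₜ[K] (c w))))
    (ha2 : ∀ (w : V ⊗[K] V) (x : LA.carrier),
      a2.act (eV.symm (I.mkQ w)) x = eA.symm (brA (c w) (eA x)))
    (aLC : LieSuperAction LA CA)
    (haLC : ∀ (x : LA.carrier) (y : CA.carrier), (eC (aLC.act x y)).1 = brA (eA x) (eC y).1)
    (aCL : LieSuperAction CA LA)
    (haCL : ∀ (y : CA.carrier) (x : LA.carrier),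
      aCL.act y x = eA.symm (brA (eC y).1 (eA x)))
    (T₂ : LieSuperalgebra K) (ι₂ : TensorData a1 a2 T₂) (h₂ : IsNATensor a1 a2 T₂ ι₂)
    (T₃ : LieSuperalgebra K) (ι₃ : TensorData aLC aCL T₃) (h₃ : IsNATensor aLC aCL T₃ ι₃)
    (ν₂ : LieSuperHom T₂ VA)
    (hν₂ : ∀ (α β : ZMod 2) (p : LA.grading α) (v : VA.grading β),
      ν₂.toLinear (ι₂.pair α β p v) = a1.act p.1 v.1)
    (ν₃ : LieSuperHom T₃ CA)
    (hν₃ : ∀ (α β : ZMod 2) (p : LA.grading α) (v : CA.grading β),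
      ν₃.toLinear (ι₃.pair α β p v) = aLC.act p.1 v.1) :
    ∃ (f₁ : ((V ⧸ C) ⊗[K] LinearMap.ker cbar) →ₗ[K] LinearMap.ker ν₂.toLinear)
      (f₂ : LinearMap.ker ν₂.toLinear →ₗ[K] LinearMap.ker ν₃.toLinear)
      (f₃ : LinearMap.ker ν₃.toLinear →ₗ[K] LinearMap.ker cbar)
      (f₄ : LinearMap.ker cbar →ₗ[K] (V ⊗[K] V ⧸ J))
      (f₅ : (V ⊗[K] V ⧸ J) →ₗ[K] (C ⧸ Submodule.comap C.subtype D)),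
      LinearMap.range f₁ = LinearMap.ker f₂ ∧
      LinearMap.range f₂ = LinearMap.ker f₃ ∧
      LinearMap.range f₃ = LinearMap.ker f₄ ∧
      LinearMap.range f₄ = LinearMap.ker f₅ ∧
      Function.Surjective f₅ := by
  have rep : ∀ v, ∃ w, eV.symm (I.mkQ w) = v := by
    intro v
    obtain ⟨w, hw⟩ := I.mkQ_surjective (eV v)
    exact ⟨w, by rw [hw, eV.symm_apply_apply]⟩
  have hφw : ∀ w, (eC (φ.toLinear (eV.symm (I.mkQ w)))).1 = c w := by
    intro w
    rw [hφ, eV.apply_symm_apply, hcbar]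
  have hφ0 : ∀ v, φ.toLinear v = 0 ↔ cbar (eV v) = 0 := by
    intro v
    rw [← hφ, Submodule.coe_eq_zero, LinearEquiv.map_eq_zero_iff]
  have hsurj : Function.Surjective φ.toLinear := by
    intro x
    obtain ⟨w, hw⟩ := hCc (eC x).1 (eC x).2
    refine ⟨eV.symm (I.mkQ w), eC.injective (Subtype.ext ?_)⟩
    rw [hφw, hw]
  have hl : ∀ p m, φ.toLinear (a1.act p m) = aLC.act p (φ.toLinear m) := by
    intro p m
    obtain ⟨w, rfl⟩ := rep m
    apply eC.injective
    apply Subtype.ext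
    rw [ha1, hφw, haLC, hφw, hc]
  have hr : ∀ m p, aCL.act (φ.toLinear m) p = a2.act m p := by
    intro m p
    obtain ⟨w, rfl⟩ := rep m
    rw [haCL, hφw, ha2]
  have hk : ∀ p m, φ.toLinear m = 0 → a1.act p m = 0 := by
    intro p m hm
    obtain ⟨w, rfl⟩ := rep m
    rw [hφ0, eV.apply_symm_apply, hcbar] at hm
    rw [ha1, hm, TensorProduct.tmul_zero, map_zero, map_zero]
  have hν₂' := ι₂.linearMap_bil ν₂.toLinear a1.act hν₂
  have hν₃' := ι₃.linearMap_bil ν₃.toLinear aLC.act hν₃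
  obtain ⟨F, σ, hFs, hFk, hσF, hφσ⟩ := h₂.exists_connecting h₃ φ hsurj hl hr hk
    ν₂.toLinear hν₂' ν₃.toLinear hν₃'
  let e₁ : V →ₗ[K] LinearMap.ker cbar →ₗ[K] T₂.carrier :=
    ι₂.bil.compl₁₂ eA.symm.toLinearMap (eV.symm.toLinearMap ∘ₗ (LinearMap.ker cbar).subtype)
  have he₁ : ∀ a h, e₁ a h = ι₂.bil (eA.symm a) (eV.symm h.1) := fun _ _ => rfl
  have hker : ∀ h : LinearMap.ker cbar, φ.toLinear (eV.symm h.1) = 0 := by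
    intro h
    rw [hφ0, eV.apply_symm_apply]
    exact h.2
  have he₁ν : ∀ a h, e₁ a h ∈ LinearMap.ker ν₂.toLinear := by
    intro a h
    rw [LinearMap.mem_ker, he₁, hν₂', hk _ _ (hker h)]
  let e₁' : V →ₗ[K] LinearMap.ker cbar →ₗ[K] LinearMap.ker ν₂.toLinear :=
    LinearMap.mk₂ K (fun a h => ⟨e₁ a h, he₁ν a h⟩)
      (fun a a' h => Subtype.ext (LinearMap.map_add₂ e₁ a a' h))
      (fun r a h => Subtype.ext (LinearMap.map_smul₂ e₁ r a h))
      (fun a h h' => Subtype.ext (map_add (e₁ a) h h'))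
      (fun r a h => Subtype.ext (map_smul (e₁ a) r h))
  have he₁C : C ≤ LinearMap.ker e₁' := by
    refine hCle _ fun α β x hx y hy => LinearMap.mem_ker.mpr (LinearMap.ext fun h => ?_)
    apply Subtype.ext
    change ι₂.bil (eA.symm (eA (LA.bracket x y))) (eV.symm h.1) = 0
    rw [eA.symm_apply_apply, ← sum_gcomp VA.isInternal (eV.symm h.1), map_sum]
    refine Finset.sum_eq_zero fun γ _ => ?_
    have h0 : φ.toLinear (gcomp VA.isInternal γ (eV.symm h.1)).1 = 0 := by
      rw [← gcomp_map VA.isInternal CA.isInternal φ.toLinear φ.map_grading, hker]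
      simp
    rw [ι₂.bil_bracket_left hx hy (gcomp VA.isInternal γ (eV.symm h.1)).2, hk _ _ h0, hk _ _ h0]
    simp
  let f₁ : ((V ⧸ C) ⊗[K] LinearMap.ker cbar) →ₗ[K] LinearMap.ker ν₂.toLinear :=
    TensorProduct.lift (C.liftQ e₁' he₁C)
  have hf₁ : ∀ a h, (f₁ (C.mkQ a ⊗ₜ[K] h)).1 = ι₂.bil (eA.symm a) (eV.symm h.1) :=
    fun _ _ => rfl
  let f₂ : LinearMap.ker ν₂.toLinear →ₗ[K] LinearMap.ker ν₃.toLinear :=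
    F.restrict fun t ht => by
      rw [LinearMap.mem_ker] at ht ⊢
      rw [← hφσ, hσF, ht, map_zero]
  have hf₂ : ∀ t, (f₂ t).1 = F t.1 := fun _ => rfl
  let f₃ : LinearMap.ker ν₃.toLinear →ₗ[K] LinearMap.ker cbar :=
    (eV.toLinearMap ∘ₗ σ).restrict fun t ht => by
      rw [LinearMap.mem_ker] at ht ⊢
      rw [LinearMap.comp_apply, LinearEquiv.coe_coe, ← hφ0, hφσ, ht]
  have hf₃ : ∀ t, (f₃ t).1 = eV (σ t.1) := fun _ => rfl
  have hIJ : I ≤ LinearMap.ker J.mkQ := by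
    rw [Submodule.ker_mkQ, hJ]
    exact le_sup_left
  let f₄ : LinearMap.ker cbar →ₗ[K] (V ⊗[K] V ⧸ J) :=
    I.liftQ J.mkQ hIJ ∘ₗ (LinearMap.ker cbar).subtype
  have hf₄ : ∀ w (hw : I.mkQ w ∈ LinearMap.ker cbar), f₄ ⟨I.mkQ w, hw⟩ = J.mkQ w :=
    fun _ _ => rfl
  let k : V ⊗[K] V →ₗ[K] C ⧸ Submodule.comap C.subtype D :=
    (Submodule.comap C.subtype D).mkQ ∘ₗ c.codRestrict C hcC
  have hk0 : ∀ w, k w = 0 ↔ c w ∈ D := by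
    intro w
    change (Submodule.comap C.subtype D).mkQ _ = 0 ↔ _
    rw [← LinearMap.mem_ker, Submodule.ker_mkQ]
    rfl
  have hJk : J ≤ LinearMap.ker k := by
    rw [hJ]
    refine sup_le ?_ (Submodule.span_le.mpr ?_)
    · intro w hw
      have : I.mkQ w = 0 := by simpa using hw
      rw [LinearMap.mem_ker, hk0, ← hcbar, this, map_zero]
      exact zero_mem _
    · rintro _ ⟨a, w, rfl⟩
      rw [SetLike.mem_coe, LinearMap.mem_ker, hk0, hc, hD]
      exact Submodule.subset_span ⟨a, c w, hcC w, rfl⟩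
  let f₅ : (V ⊗[K] V ⧸ J) →ₗ[K] (C ⧸ Submodule.comap C.subtype D) := J.liftQ k hJk
  have hf₅ : ∀ w, f₅ (J.mkQ w) = k w := fun _ => rfl
  refine ⟨f₁, f₂, f₃, f₄, f₅, le_antisymm ?_ ?_, le_antisymm ?_ ?_, le_antisymm ?_ ?_,
    le_antisymm ?_ ?_, ?_⟩
  · rw [LinearMap.range_le_ker_iff]
    refine TensorProduct.ext' fun a h => ?_
    obtain ⟨a, rfl⟩ := C.mkQ_surjective a
    apply Subtype.ext
    rw [LinearMap.comp_apply, hf₂, hf₁]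
    change _ ∈ LinearMap.ker F
    rw [hFk]
    exact Submodule.subset_span ⟨_, _, hker h, rfl⟩
  · intro t ht
    have ht' : t.1 ∈ LinearMap.ker F := congrArg Subtype.val (LinearMap.mem_ker.mp ht)
    suffices LinearMap.ker F ≤ (LinearMap.range f₁).map (LinearMap.ker ν₂.toLinear).subtype by
      obtain ⟨s, hs, hst⟩ := this ht'
      rwa [← Subtype.ext hst]
    rw [hFk, Submodule.span_le]
    rintro _ ⟨p, m, hm, rfl⟩
    refine ⟨f₁ (C.mkQ (eA p) ⊗ₜ[K] ⟨eV m, (hφ0 m).mp hm⟩), ⟨_, rfl⟩, ?_⟩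
    rw [Submodule.subtype_apply, hf₁, eA.symm_apply_apply, eV.symm_apply_apply]
  · rintro _ ⟨t, rfl⟩
    apply Subtype.ext
    rw [hf₃, hf₂, hσF, LinearMap.mem_ker.mp t.2, map_zero]
    rfl
  · intro x hx
    obtain ⟨t, ht⟩ := hFs x.1
    have h0 : eV (σ x.1) = 0 := congrArg Subtype.val (LinearMap.mem_ker.mp hx)
    rw [LinearEquiv.map_eq_zero_iff, ← ht, hσF] at h0
    exact ⟨⟨t, h0⟩, Subtype.ext ht⟩
  · rintro _ ⟨x, rfl⟩
    obtain ⟨t, ht⟩ := hFs x.1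
    rw [LinearMap.mem_ker]
    change (I.liftQ J.mkQ hIJ) (eV (σ x.1)) = 0
    rw [← ht, hσF]
    suffices (I.liftQ J.mkQ hIJ ∘ₗ eV.toLinearMap) ∘ₗ ν₂.toLinear = 0 from
      LinearMap.congr_fun this t
    refine h₂.linearMap_ext fun p m => ?_
    obtain ⟨w, rfl⟩ := rep m
    rw [LinearMap.comp_apply, hν₂', ha1, LinearMap.comp_apply, LinearEquiv.coe_coe,
      eV.apply_symm_apply]
    change J.mkQ _ = 0
    rw [← LinearMap.mem_ker, Submodule.ker_mkQ, hJ]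
    exact Submodule.mem_sup_right (Submodule.subset_span ⟨_, _, rfl⟩)
  · rintro ⟨x, hx⟩ hx4
    obtain ⟨w, rfl⟩ := I.mkQ_surjective x
    have hw : w ∈ J := by
      rw [LinearMap.mem_ker, hf₄] at hx4
      simpa using hx4
    have hJν : J ≤ (LinearMap.range ν₂.toLinear).comap (eV.symm.toLinearMap ∘ₗ I.mkQ) := by
      rw [hJ]
      refine sup_le ?_ (Submodule.span_le.mpr ?_)
      · intro w hw
        have : I.mkQ w = 0 := by simpa using hw
        rw [Submodule.mem_comap, LinearMap.comp_apply, this, map_zero]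
        exact zero_mem _
      · rintro _ ⟨a, w, rfl⟩
        refine ⟨ι₂.bil (eA.symm a) (eV.symm (I.mkQ w)), ?_⟩
        rw [hν₂', ha1, eA.apply_symm_apply]
        rfl
    obtain ⟨t, ht⟩ := hJν hw
    have ht' : eV (ν₂.toLinear t) = I.mkQ w := by
      rw [ht]
      exact eV.apply_symm_apply _
    refine ⟨⟨F t, ?_⟩, Subtype.ext ?_⟩
    · rw [LinearMap.mem_ker, ← hφσ, hσF, hφ0, ht']
      exact hx
    · rw [hf₃, hσF, ht']
  · rintro _ ⟨⟨x, hx⟩, rfl⟩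
    obtain ⟨w, rfl⟩ := I.mkQ_surjective x
    rw [LinearMap.mem_ker, hcbar] at hx
    rw [LinearMap.mem_ker, hf₄, hf₅, hk0, hx]
    exact zero_mem _
  · intro x hx
    obtain ⟨w, rfl⟩ := J.mkQ_surjective x
    rw [LinearMap.mem_ker, hf₅, hk0] at hx
    have hDJ : D ≤ J.map c := by
      rw [hD, Submodule.span_le]
      rintro _ ⟨a, y, hy, rfl⟩
      obtain ⟨w, rfl⟩ := hCc y hy
      refine ⟨a ⊗ₜ[K] c w, ?_, hc _ _⟩
      rw [hJ]
      exact Submodule.mem_sup_right (Submodule.subset_span ⟨_, _, rfl⟩)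
    obtain ⟨u, hu, huw⟩ := hDJ hx
    have hwu : I.mkQ (w - u) ∈ LinearMap.ker cbar := by
      rw [LinearMap.mem_ker, hcbar, map_sub, huw, sub_self]
    refine ⟨⟨I.mkQ (w - u), hwu⟩, ?_⟩
    have hu0 : J.mkQ u = 0 := by simpa using hu
    rw [hf₄, map_sub, hu0, sub_zero]
  · intro y
    obtain ⟨y, rfl⟩ := Submodule.mkQ_surjective _ y
    obtain ⟨w, hw⟩ := hCc y.1 y.2
    refine ⟨J.mkQ w, ?_⟩
    rw [hf₅]
    exact congrArg _ (Subtype.ext hw)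

end SixTerm

/-- For a unital associative superalgebra `A` there is an exact
sequence of supermodules
`(A/[A,A]) ⊗_K HC₁(A) → H̄₁(A,V(A)) → H̄₁(A,[A,A]) → HC₁(A) → HC₁^M(A) → [A,A]/[A,[A,A]] → 0`. -/
theorem statement14 {K : Type} [CommRing K] (A : AssocSuperalgebra K)
    -- the super-commutator bracket of `A`
    (brA : A.carrier →ₗ[K] A.carrier →ₗ[K] A.carrier)
    (hbrA : ∀ (α β : ZMod 2) (a : A.grading α) (b : A.grading β),
      brA a.1 b.1 = a.1 * b.1 - ssign α β • (b.1 * a.1))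
    -- `A` regarded as a Lie superalgebra
    (LA : LieSuperalgebra K) (eA : LA.carrier ≃ₗ[K] A.carrier)
    (hLAgr : ∀ γ : ZMod 2, (LA.grading γ).map eA.toLinearMap = A.grading γ)
    (hLAbr : ∀ x y : LA.carrier, eA (LA.bracket x y) = brA (eA x) (eA y))
    -- the linear map `A ⊗_K A → A`, `a ⊗ b ↦ [a,b]`
    (c : A.carrier ⊗[K] A.carrier →ₗ[K] A.carrier)
    (hc : ∀ a b : A.carrier, c (a ⊗ₜ[K] b) = brA a b)
    -- `V(A)`
    (VA : LieSuperalgebra K)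
    (eV : VA.carrier ≃ₗ[K] (A.carrier ⊗[K] A.carrier ⧸ IA A.toNu))
    (hVgr : ∀ γ : ZMod 2, (VA.grading γ).map eV.toLinearMap
      = gradeQuot (gradeTensor A.grading A.grading) (IA A.toNu) γ)
    (hVbr : ∀ w w' : A.carrier ⊗[K] A.carrier,
      eV (VA.bracket (eV.symm ((IA A.toNu).mkQ w)) (eV.symm ((IA A.toNu).mkQ w')))
        = (IA A.toNu).mkQ ((c w) ⊗ₜ[K] (c w')))
    (cbar : (A.carrier ⊗[K] A.carrier ⧸ IA A.toNu) →ₗ[K] A.carrier)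
    (hcbar : ∀ w : A.carrier ⊗[K] A.carrier, cbar ((IA A.toNu).mkQ w) = c w)
    -- `[A,A]` regarded as a Lie superalgebra
    (CA : LieSuperalgebra K) (eC : CA.carrier ≃ₗ[K] commSpan A.toNu)
    (hCgr : ∀ γ : ZMod 2, (CA.grading γ).map eC.toLinearMap
      = gradeSub A.grading (commSpan A.toNu) γ)
    (hCbr : ∀ x y : CA.carrier, (eC (CA.bracket x y)).1
      = brA (eC x).1 (eC y).1)
    -- the crossed-module actions
    (a1 : LieSuperAction LA VA) (a2 : LieSuperAction VA LA)
    (ha1 : ∀ (x : LA.carrier) (w : A.carrier ⊗[K] A.carrier),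
      a1.act x (eV.symm ((IA A.toNu).mkQ w))
        = eV.symm ((IA A.toNu).mkQ ((eA x) ⊗ₜ[K] (c w))))
    (ha2 : ∀ (w : A.carrier ⊗[K] A.carrier) (x : LA.carrier),
      a2.act (eV.symm ((IA A.toNu).mkQ w)) x = eA.symm (brA (c w) (eA x)))
    (aLC : LieSuperAction LA CA)
    (haLC : ∀ (x : LA.carrier) (y : CA.carrier),
      (eC (aLC.act x y)).1 = brA (eA x) (eC y).1)
    (aCL : LieSuperAction CA LA)
    (haCL : ∀ (y : CA.carrier) (x : LA.carrier),
      aCL.act y x = eA.symm (brA (eC y).1 (eA x)))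
    -- the non-abelian tensor products `A ⊗ V(A)` and `A ⊗ [A,A]`
    (T₂ : LieSuperalgebra K) (ι₂ : TensorData a1 a2 T₂) (h₂ : IsNATensor a1 a2 T₂ ι₂)
    (T₃ : LieSuperalgebra K) (ι₃ : TensorData aLC aCL T₃) (h₃ : IsNATensor aLC aCL T₃ ι₃)
    (ν₂ : LieSuperHom T₂ VA)
    (hν₂ : ∀ (α β : ZMod 2) (p : LA.grading α) (v : VA.grading β),
      ν₂.toLinear (ι₂.pair α β p v) = a1.act p.1 v.1)
    (ν₃ : LieSuperHom T₃ CA)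
    (hν₃ : ∀ (α β : ZMod 2) (p : LA.grading α) (v : CA.grading β),
      ν₃.toLinear (ι₃.pair α β p v) = aLC.act p.1 v.1) :
    -- the six-term exact sequence
    ∃ (f₁ : ((A.carrier ⧸ commSpan A.toNu) ⊗[K] LinearMap.ker cbar) →ₗ[K]
          (LinearMap.ker ν₂.toLinear : Submodule K T₂.carrier))
      (f₂ : (LinearMap.ker ν₂.toLinear : Submodule K T₂.carrier) →ₗ[K]
          (LinearMap.ker ν₃.toLinear : Submodule K T₃.carrier))
      (f₃ : (LinearMap.ker ν₃.toLinear : Submodule K T₃.carrier) →ₗ[K]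
          (LinearMap.ker cbar : Submodule K (A.carrier ⊗[K] A.carrier ⧸ IA A.toNu)))
      (f₄ : (LinearMap.ker cbar : Submodule K (A.carrier ⊗[K] A.carrier ⧸ IA A.toNu)) →ₗ[K]
          (A.carrier ⊗[K] A.carrier ⧸ JA A.toNu))
      (f₅ : (A.carrier ⊗[K] A.carrier ⧸ JA A.toNu) →ₗ[K]
          ((commSpan A.toNu : Submodule K A.carrier) ⧸
            Submodule.comap (commSpan A.toNu).subtype (commSpan2 A.toNu brA))),
      LinearMap.range f₁ = LinearMap.ker f₂ ∧
      LinearMap.range f₂ = LinearMap.ker f₃ ∧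
      LinearMap.range f₃ = LinearMap.ker f₄ ∧
      LinearMap.range f₄ = LinearMap.ker f₅ ∧
      Function.Surjective f₅ := by
  have hcC := map_mem_commSpan hbrA hc
  have hCle : ∀ S : Submodule K A.carrier, (∀ α β, ∀ x ∈ LA.grading α, ∀ y ∈ LA.grading β,
      eA (LA.bracket x y) ∈ S) → commSpan A.toNu ≤ S := by
    intro S hS
    refine Submodule.span_le.mpr ?_
    rintro _ ⟨α, β, a, b, rfl⟩
    have ha : a.1 ∈ (LA.grading α).map eA.toLinearMap := (hLAgr α).symm ▸ a.2
    have hb : b.1 ∈ (LA.grading β).map eA.toLinearMap := (hLAgr β).symm ▸ b.2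
    obtain ⟨x, hx, hxa⟩ := ha
    obtain ⟨y, hy, hyb⟩ := hb
    have h := hS α β x hx y hy
    rw [hLAbr, show eA x = a.1 from hxa, show eA y = b.1 from hyb, hbrA α β a b] at h
    exact h
  obtain ⟨φ, hφ⟩ := exists_commutatorHom A.grading hc hcC
    (fun γ w hw => map_mem_grading hbrA hc hw) hcbar hVgr hVbr hCgr hCbr
  exact exists_sixTerm hc hcC (fun x hx => exists_of_mem_commSpan hbrA hc hx) hCle rfl
    (JA_eq_sup hbrA hc) hcbar φ hφ a1 a2 ha1 ha2 aLC haLC aCL haCL T₂ ι₂ h₂ T₃ ι₃ h₃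
    ν₂ hν₂ ν₃ hν₃

end SuperNA
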